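/- Let p be a prime, F = 𝔽_p, G a finite group, and K ⊆ L finite field extensions of F. Let W be an indecomposable FG-module, V an indecomposable KG-module, and U an indecomposable LG-module with U | V ⊗_K L. Then V | W ⊗_F K if and only if U | W ⊗_F L. -/

import Mathlib

open TensorProduct

/-- Base change of a representation along a (commutative) algebra `k → L`:
the `L`-linear representation of `G` on `V ⊗_k L = L ⊗[k] V`. -/
noncomputable def repBaseChange {k : Type*} [CommRing k] (L : Type*) [CommRing L] [Algebra k L]
    {G : Type*} [Monoid G] {V : Type*} [AddCommGroup V] [Module k V]
    (ρ : Representation k G V) : Representation L G (L ⊗[k] V) :=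
  (Module.End.baseChangeHom k L V).toRingHom.toMonoidHom.comp ρ

/-- Restriction of scalars `Res_K` of a representation along `K ⊆ L`. -/
def repRes (K : Type*) {L : Type*} [CommRing K] [CommRing L] [Algebra K L]
    {G : Type*} [Monoid G] {U : Type*} [AddCommGroup U] [Module K U] [Module L U]
    [IsScalarTower K L U] (ρ : Representation L G U) : Representation K G U where
  toFun g := (ρ g).restrictScalars K
  map_one' := by ext u; simp
  map_mul' g h := by ext u; simp

/-- Two representations of `G` over `k` are isomorphic iff the corresponding modules over the
group algebra `MonoidAlgebra k G` are linearly equivalent. -/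
def RepIso {k : Type*} [CommSemiring k] {G : Type*} [Monoid G]
    {V W : Type*} [AddCommMonoid V] [Module k V] [AddCommMonoid W] [Module k W]
    (ρ : Representation k G V) (τ : Representation k G W) : Prop :=
  Nonempty (ρ.asModule ≃ₗ[MonoidAlgebra k G] τ.asModule)

/-- `ρ | τ` : `ρ` is (isomorphic to) a direct summand of `τ`, i.e. `τ` is the internal direct
sum of two submodules (over the group algebra `MonoidAlgebra k G`), the first of which is
isomorphic to `ρ`. -/
def RepSummand {k : Type*} [CommSemiring k] {G : Type*} [Monoid G]
    {V W : Type*} [AddCommMonoid V] [Module k V] [AddCommMonoid W] [Module k W]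
    (ρ : Representation k G V) (τ : Representation k G W) : Prop :=
  ∃ A B : Submodule (MonoidAlgebra k G) τ.asModule,
    IsCompl A B ∧ Nonempty (ρ.asModule ≃ₗ[MonoidAlgebra k G] A)

/-- A representation is indecomposable if it is nonzero and the corresponding module over the
group algebra is not the internal direct sum of two nonzero submodules. -/
def RepIndecomposable {k : Type*} [CommSemiring k] {G : Type*} [Monoid G]
    {V : Type*} [AddCommMonoid V] [Module k V] (ρ : Representation k G V) : Prop :=
  Nontrivial V ∧
    ∀ A B : Submodule (MonoidAlgebra k G) ρ.asModule, IsCompl A B → A = ⊥ ∨ B = ⊥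

/-- A representation is simple if the corresponding module over the group algebra is simple. -/
def RepSimple {k : Type*} [CommRing k] {G : Type*} [Monoid G]
    {V : Type*} [AddCommGroup V] [Module k V] (ρ : Representation k G V) : Prop :=
  IsSimpleModule (MonoidAlgebra k G) ρ.asModule

section Modules

variable {R M N X : Type*} [Ring R] [AddCommGroup M] [Module R M] [AddCommGroup N] [Module R N]
  [AddCommGroup X] [Module R X]

/-- A module is isomorphic to a direct summand of another one iff it is a retract of it. -/
lemma exists_isCompl_equiv_iff_exists_retract :
    (∃ A B : Submodule R N, IsCompl A B ∧ Nonempty (M ≃ₗ[R] A)) ↔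
      ∃ (i : M →ₗ[R] N) (π : N →ₗ[R] M), π ∘ₗ i = LinearMap.id := by
  constructor
  · rintro ⟨A, B, hAB, ⟨e⟩⟩
    refine ⟨A.subtype ∘ₗ e, e.symm ∘ₗ A.projectionOnto B hAB, LinearMap.ext fun x ↦ ?_⟩
    change e.symm (A.projectionOnto B hAB (e x)) = x
    rw [Submodule.projectionOnto_apply_left, e.symm_apply_apply]
  · rintro ⟨i, π, h⟩
    have h' : ∀ x, π (i x) = x := fun x ↦ LinearMap.congr_fun h x
    refine ⟨LinearMap.range i, LinearMap.ker π, ⟨?_, ?_⟩,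
      ⟨LinearEquiv.ofInjective i (Function.LeftInverse.injective h')⟩⟩
    · rw [Submodule.disjoint_def]
      rintro _ ⟨x, rfl⟩ hx
      rw [LinearMap.mem_ker, h'] at hx
      simp [hx]
    · rw [codisjoint_iff, Submodule.eq_top_iff']
      intro y
      rw [Submodule.mem_sup]
      exact ⟨i (π y), ⟨_, rfl⟩, y - i (π y), by simp [h'], by simp⟩

/-- Fitting's lemma. -/
lemma isUnit_or_isNilpotent_of_indecomposable [IsArtinian R M] [IsNoetherian R M]
    (hM : ∀ A B : Submodule R M, IsCompl A B → A = ⊥ ∨ B = ⊥) (f : Module.End R M) :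
    IsUnit f ∨ IsNilpotent f := by
  obtain ⟨n, hn, hn0⟩ :=
    (f.eventually_isCompl_ker_pow_range_pow.and (Filter.eventually_ne_atTop 0)).exists
  rcases hM _ _ hn with h | h
  · left
    rw [← isUnit_pow_iff hn0, Module.End.isUnit_iff]
    refine ⟨LinearMap.ker_eq_bot.1 h, LinearMap.range_eq_top.1 ?_⟩
    simpa [h] using hn.sup_eq_top
  · exact Or.inr ⟨n, LinearMap.range_eq_bot.1 h⟩

lemma isLocalRing_end_of_indecomposable [IsArtinian R M] [IsNoetherian R M] [Nontrivial M]
    (hM : ∀ A B : Submodule R M, IsCompl A B → A = ⊥ ∨ B = ⊥) :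
    IsLocalRing (Module.End R M) :=
  .of_isUnit_or_isUnit_one_sub_self fun f ↦
    (isUnit_or_isNilpotent_of_indecomposable hM f).imp_right (·.isUnit_one_sub)

lemma mem_jacobson_bot_of_not_isUnit_of_indecomposable [IsArtinian R M] [IsNoetherian R M]
    (hM : ∀ A B : Submodule R M, IsCompl A B → A = ⊥ ∨ B = ⊥) {f : Module.End R M}
    (hf : ¬ IsUnit f) : f ∈ (⊥ : Ideal (Module.End R M)).jacobson := by
  rw [Ideal.mem_jacobson_iff]
  intro g
  have hgf : ¬ IsUnit (g * f) := by
    intro h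
    rw [Module.End.isUnit_iff] at h hf
    have hinj : Function.Injective f := Function.Injective.of_comp h.1
    exact hf (IsArtinian.bijective_of_injective_endomorphism f hinj)
  obtain ⟨u, hu⟩ :=
    ((isUnit_or_isNilpotent_of_indecomposable hM (g * f)).resolve_left hgf).isUnit_one_add
  refine ⟨(u⁻¹ : (Module.End R M)ˣ), ?_⟩
  rw [Ideal.mem_bot, mul_assoc, sub_eq_zero, ← mul_add_one, add_comm, ← hu, Units.inv_mul]

lemma eq_zero_of_isIdempotentElem_of_mem_jacobson_bot {e : R} (he : IsIdempotentElem e)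
    (hJ : e ∈ (⊥ : Ideal R).jacobson) : e = 0 := by
  obtain ⟨z, hz⟩ := Ideal.mem_jacobson_iff.1 hJ (-1)
  rw [Ideal.mem_bot] at hz
  have h : (z * -1 * e + z - 1) * e = 0 := by rw [hz, zero_mul]
  have h2 : (z * -1 * e + z - 1) * e = -e := by
    simp [sub_mul, add_mul, mul_assoc, he.eq]
  rw [h2] at h
  simpa using h

/-- If a nonzero module is a retract of both a finite power of `M` and a finite power of `N`, and
`M` is indecomposable of finite length, then `M` is a retract of `N`. -/
lemma exists_retract_of_retract_powers [IsArtinian R M] [IsNoetherian R M] [Nontrivial M]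
    [Nontrivial X] (hM : ∀ A B : Submodule R M, IsCompl A B → A = ⊥ ∨ B = ⊥)
    {ι κ : Type*} [Fintype ι] [Fintype κ]
    (i : ι → X →ₗ[R] M) (π : ι → M →ₗ[R] X) (hi : ∑ j, π j ∘ₗ i j = LinearMap.id)
    (r : κ → X →ₗ[R] N) (q : κ → N →ₗ[R] X) (hr : ∑ l, q l ∘ₗ r l = LinearMap.id) :
    ∃ (a : M →ₗ[R] N) (b : N →ₗ[R] M), b ∘ₗ a = LinearMap.id := by
  classical
  have := isLocalRing_end_of_indecomposable hM
  have hi' : ∀ x, ∑ j, π j (i j x) = x := fun x ↦ by simpa using LinearMap.congr_fun hi x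
  have hr' : ∀ x, ∑ l, q l (r l x) = x := fun x ↦ by simpa using LinearMap.congr_fun hr x
  let e : Matrix ι ι (Module.End R M) := fun j k ↦ i j ∘ₗ π k
  by_cases hunit : ∃ j k, IsUnit (e j k)
  · obtain ⟨j, k, hjk⟩ := hunit
    have hsum : e j k = ∑ l, ((i j ∘ₗ q l) ∘ₗ (r l ∘ₗ π k) : Module.End R M) := by
      ext x
      simp [e, ← map_sum, hr']
    rw [hsum] at hjk
    obtain ⟨l, -, u, hu⟩ := IsLocalRing.exists_of_isUnit_sum hjk
    refine ⟨r l ∘ₗ π k, (u⁻¹ : (Module.End R M)ˣ).1 ∘ₗ (i j ∘ₗ q l), ?_⟩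
    rw [LinearMap.comp_assoc, ← hu]
    exact u.inv_mul
  · push Not at hunit
    have he : IsIdempotentElem e := by
      ext j k x
      rw [Matrix.mul_apply, LinearMap.sum_apply]
      change ∑ l, i j (π l (i l (π k x))) = i j (π k x)
      rw [← map_sum, hi']
    have hJ : e ∈ (⊥ : Ideal (Matrix ι ι (Module.End R M))).jacobson := by
      have := Ideal.matrix_jacobson_le (n := ι) (⊥ : Ideal (Module.End R M))
        (x := e) fun j k ↦ mem_jacobson_bot_of_not_isUnit_of_indecomposable hM (hunit j k)
      simpa using this
    have he0 := eq_zero_of_isIdempotentElem_of_mem_jacobson_bot he hJ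
    obtain ⟨x, hx⟩ := exists_ne (0 : X)
    refine absurd ?_ hx
    have hz : ∀ j k y, i j (π k y) = 0 := fun j k y ↦
      LinearMap.congr_fun (congr_fun (congr_fun he0 j) k) y
    have h0 : ∀ j, i j x = 0 := fun j ↦ by
      rw [← hi' x, map_sum]
      simp [hz]
    rw [← hi' x]
    simp [h0]

end Modules

section Representations

variable {k G V W : Type*} [CommRing k] [Group G] [AddCommGroup V] [Module k V]
  [AddCommGroup W] [Module k W]

lemma repSummand_iff_exists_retract {ρ : Representation k G V} {τ : Representation k G W} :
    RepSummand ρ τ ↔ ∃ (i : ρ.IntertwiningMap τ) (π : τ.IntertwiningMap ρ), ∀ v, π (i v) = v := by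
  rw [RepSummand, exists_isCompl_equiv_iff_exists_retract]
  constructor
  · rintro ⟨i, π, h⟩
    exact ⟨(Representation.IntertwiningMap.equivLinearMapAsModule ρ τ).symm i,
      (Representation.IntertwiningMap.equivLinearMapAsModule τ ρ).symm π,
      fun v ↦ LinearMap.congr_fun h v⟩
  · rintro ⟨i, π, h⟩
    exact ⟨Representation.IntertwiningMap.equivLinearMapAsModule ρ τ i,
      Representation.IntertwiningMap.equivLinearMapAsModule τ ρ π, LinearMap.ext h⟩

lemma RepSummand.trans {U : Type*} [AddCommGroup U] [Module k U] {σ : Representation k G U}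
    {ρ : Representation k G V} {τ : Representation k G W}
    (h₁ : RepSummand σ ρ) (h₂ : RepSummand ρ τ) : RepSummand σ τ := by
  rw [repSummand_iff_exists_retract] at *
  obtain ⟨i, π, h⟩ := h₁
  obtain ⟨i', π', h'⟩ := h₂
  exact ⟨i'.comp i, π.comp π', fun v ↦ by simp [h, h']⟩

variable (L : Type*) [CommRing L] [Algebra k L]

@[simp] lemma repBaseChange_tmul (ρ : Representation k G V) (g : G) (a : L) (v : V) :
    repBaseChange L ρ g (a ⊗ₜ v) = a ⊗ₜ ρ g v := rfl

/-- Base change of an intertwining map. -/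
noncomputable def Representation.IntertwiningMap.repBaseChange {ρ : Representation k G V}
    {τ : Representation k G W} (f : ρ.IntertwiningMap τ) :
    (_root_.repBaseChange L ρ).IntertwiningMap (_root_.repBaseChange L τ) where
  toLinearMap := f.toLinearMap.baseChange L
  isIntertwining' g := by
    ext v
    simp [f.isIntertwining]

lemma RepSummand.repBaseChange {ρ : Representation k G V} {τ : Representation k G W}
    (h : RepSummand ρ τ) : RepSummand (repBaseChange L ρ) (repBaseChange L τ) := by
  rw [repSummand_iff_exists_retract] at *
  obtain ⟨i, π, h⟩ := h
  refine ⟨i.repBaseChange L, π.repBaseChange L, fun x ↦ ?_⟩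
  have : π.toLinearMap ∘ₗ i.toLinearMap = LinearMap.id := LinearMap.ext h
  change (π.toLinearMap.baseChange L) (i.toLinearMap.baseChange L x) = x
  rw [← LinearMap.comp_apply, ← LinearMap.baseChange_comp, this, LinearMap.baseChange_id,
    LinearMap.id_apply]

/-- Transitivity of base change for representations. -/
noncomputable def repBaseChangeTower (K : Type*) [CommRing K] [Algebra k K] [Algebra K L]
    [IsScalarTower k K L] (ρ : Representation k G V) :
    (repBaseChange L (repBaseChange K ρ)).Equiv (repBaseChange L ρ) :=
  .mk (TensorProduct.AlgebraTensorModule.cancelBaseChange k K L L V) fun g ↦ by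
    ext v
    simp

lemma Representation.Equiv.repSummand {ρ : Representation k G V} {τ : Representation k G W}
    (e : ρ.Equiv τ) : RepSummand ρ τ :=
  repSummand_iff_exists_retract.2
    ⟨e.toIntertwiningMap, e.symm.toIntertwiningMap, fun v ↦ e.symm_apply_apply v⟩

variable {L} in
/-- Restriction of scalars of an intertwining map. -/
def Representation.IntertwiningMap.repRes (k : Type*) [CommRing k] [Algebra k L]
    {V W : Type*} [AddCommGroup V] [Module k V] [Module L V] [IsScalarTower k L V]
    [AddCommGroup W] [Module k W] [Module L W] [IsScalarTower k L W]
    {ρ : Representation L G V} {τ : Representation L G W} (f : ρ.IntertwiningMap τ) :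
    (_root_.repRes k ρ).IntertwiningMap (_root_.repRes k τ) where
  toLinearMap := f.toLinearMap.restrictScalars k
  isIntertwining' g := LinearMap.ext fun v ↦ f.isIntertwining _ _ g v

variable {L}

/-- The intertwining map `v ↦ a ⊗ v`. -/
noncomputable def repResBaseChangeMk (ρ : Representation k G V) (a : L) :
    ρ.IntertwiningMap (repRes k (repBaseChange L ρ)) where
  toLinearMap := TensorProduct.mk k L V a
  isIntertwining' _ := LinearMap.ext fun _ ↦ rfl

/-- The intertwining map `a ⊗ v ↦ f a • v`. -/
noncomputable def repResBaseChangeCoord (ρ : Representation k G V) (f : L →ₗ[k] k) :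
    (repRes k (repBaseChange L ρ)).IntertwiningMap ρ where
  toLinearMap := TensorProduct.lift (LinearMap.lsmul k V ∘ₗ f)
  isIntertwining' g := TensorProduct.ext' fun a v ↦ by
    change f a • ρ g v = ρ g (f a • v)
    rw [map_smul]

lemma sum_repResBaseChangeMk_coord {ι : Type*} [Fintype ι] (b : Module.Basis ι k L)
    (ρ : Representation k G V) (x : L ⊗[k] V) :
    ∑ j, repResBaseChangeMk ρ (b j) (repResBaseChangeCoord ρ (b.coord j) x) = x := by
  induction x with
  | zero => simp
  | add x y hx hy => simp only [map_add, Finset.sum_add_distrib, hx, hy]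
  | tmul a v =>
    change ∑ j, b j ⊗ₜ[k] (b.repr a j • v) = _
    simp_rw [TensorProduct.tmul_smul, TensorProduct.smul_tmul', ← TensorProduct.sum_tmul,
      b.sum_repr]

/-- A summand of a base change is, after restriction of scalars, a retract of a finite power of
the original representation. -/
lemma RepSummand.exists_sum_comp_eq_id {U : Type*} [AddCommGroup U] [Module k U] [Module L U]
    [IsScalarTower k L U] {σ : Representation L G U} {ρ : Representation k G V}
    (h : RepSummand σ (_root_.repBaseChange L ρ)) {ι : Type*} [Fintype ι]
    (b : Module.Basis ι k L) :
    ∃ (i : ι → (repRes k σ).asModule →ₗ[MonoidAlgebra k G] ρ.asModule)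
      (π : ι → ρ.asModule →ₗ[MonoidAlgebra k G] (repRes k σ).asModule),
      ∑ j, π j ∘ₗ i j = LinearMap.id := by
  obtain ⟨i, π, h⟩ := repSummand_iff_exists_retract.1 h
  refine ⟨fun j ↦ Representation.IntertwiningMap.equivLinearMapAsModule _ _
      ((repResBaseChangeCoord ρ (b.coord j)).comp (i.repRes k)),
    fun j ↦ Representation.IntertwiningMap.equivLinearMapAsModule _ _
      ((π.repRes k).comp (repResBaseChangeMk ρ (b j))), LinearMap.ext fun u ↦ ?_⟩
  rw [LinearMap.sum_apply]
  change ∑ j, π.repRes k (repResBaseChangeMk ρ (b j)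
    (repResBaseChangeCoord ρ (b.coord j) (i u))) = u
  rw [← map_sum, sum_repResBaseChangeMk_coord]
  exact h u

/-- If two base changes have a common nonzero summand and one of the original representations is
indecomposable, then it is a summand of the other one. -/
lemma RepIndecomposable.repSummand_of_baseChange {K L G U V W : Type*} [Field K] [Field L]
    [Algebra K L] [FiniteDimensional K L] [Group G] [AddCommGroup U] [Module K U] [Module L U]
    [IsScalarTower K L U] [AddCommGroup V] [Module K V] [FiniteDimensional K V] [AddCommGroup W]
    [Module K W] {σ : Representation L G U} {ρ : Representation K G V} {τ : Representation K G W}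
    (hρ : RepIndecomposable ρ) (hU : Nontrivial U) (h₁ : RepSummand σ (repBaseChange L ρ))
    (h₂ : RepSummand σ (repBaseChange L τ)) : RepSummand ρ τ := by
  have : Nontrivial (repRes K σ).asModule := hU
  have : Nontrivial ρ.asModule := hρ.1
  have : IsArtinian (MonoidAlgebra K G) ρ.asModule := isArtinian_of_tower K inferInstance
  have : IsNoetherian (MonoidAlgebra K G) ρ.asModule := isNoetherian_of_tower K inferInstance
  let b := Module.finBasis K L
  obtain ⟨i, π, hi⟩ := h₁.exists_sum_comp_eq_id b
  obtain ⟨r, q, hr⟩ := h₂.exists_sum_comp_eq_id b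
  exact exists_isCompl_equiv_iff_exists_retract.2
    (exists_retract_of_retract_powers hρ.2 i π hi r q hr)

end Representations

/-- Let `F = 𝔽_p`, `K ⊆ L` finite extensions of `F`, `W` an indecomposable `FG`-module, `V` an
indecomposable `KG`-module, and `U` an indecomposable `LG`-module with `U | V ⊗_K L`.  Then
`V | W ⊗_F K ↔ U | W ⊗_F L`. -/
theorem summand_baseChange_iff_of_summand_baseChange (p : ℕ) [Fact p.Prime]
    (K L : Type) [Field K] [Field L]
    [Algebra (ZMod p) K] [Algebra (ZMod p) L] [Algebra K L] [IsScalarTower (ZMod p) K L]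
    [FiniteDimensional (ZMod p) K] [FiniteDimensional (ZMod p) L]
    (G : Type) [Group G] [Finite G]
    (W : Type) [AddCommGroup W] [Module (ZMod p) W] [FiniteDimensional (ZMod p) W]
    (ρW : Representation (ZMod p) G W) (hW : RepIndecomposable ρW)
    (V : Type) [AddCommGroup V] [Module K V] [FiniteDimensional K V]
    (ρV : Representation K G V) (hV : RepIndecomposable ρV)
    (U : Type) [AddCommGroup U] [Module L U] [FiniteDimensional L U]
    (ρU : Representation L G U) (hU : RepIndecomposable ρU)
    (hUV : RepSummand ρU (repBaseChange L ρV)) :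
    RepSummand ρV (repBaseChange K ρW) ↔ RepSummand ρU (repBaseChange L ρW) := by
  have tower := repBaseChangeTower L K ρW
  let : Module K U := Module.compHom U (algebraMap K L)
  have : IsScalarTower K L U := .of_algebraMap_smul fun _ _ ↦ rfl
  have : FiniteDimensional K L := .right (ZMod p) K L
  exact ⟨fun h ↦ (hUV.trans (h.repBaseChange L)).trans tower.repSummand,
    fun h ↦ hV.repSummand_of_baseChange hU.1 hUV (h.trans tower.symm.repSummand)⟩
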